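/- (Bernstein-type concentration for Markov chains with restarts.) Let η ≥ 1, let μ be an η-regular probability mass function on a finite set Z, and let P₁, …, P_{H−1} be η-regular row-stochastic matrices on Z (each then has all entries positive and admits a stationary distribution). Let φ₁, …, φ_H : Z → ℝ, not all constant. With the convention P₀(z,·) := μ for every z ∈ Z, set V := (1 + √2·η·(2η−1))² · max_{z∈Z} max_{1≤ℓ≤h≤H} Var_{P_{ℓ−1}(z,·)}[φ_h] and M := 2·(2η−1)·max_{1≤h≤H} ‖φ_h‖_∞. Then for every ρ ≥ 0, the probability under the T-episode law W that Σ_{t=1}^{T} Σ_{h=1}^{H} ( φ_h(X_h^{(t)}) − E_μ[φ_h(X_h)] ) > ρ is at most exp( −ρ² / ( 2·T·H·V + (2/3)·M·ρ ) ). -/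

import Mathlib

open Finset

/-- `μ` is a probability mass function on the finite type `Z`. -/
def IsPMF {Z : Type*} [Fintype Z] (μ : Z → ℝ) : Prop :=
  (∀ z, 0 ≤ μ z) ∧ ∑ z, μ z = 1

/-- An `η`-regular PMF: `μ x ≤ η * μ y` for all `x, y`. -/
def IsRegularPMF {Z : Type*} [Fintype Z] (η : ℝ) (μ : Z → ℝ) : Prop :=
  IsPMF μ ∧ ∀ x y, μ x ≤ η * μ y

/-- A row-stochastic kernel on `Z`. -/
def IsRowStochastic {Z : Type*} [Fintype Z] (P : Z → Z → ℝ) : Prop :=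
  (∀ x y, 0 ≤ P x y) ∧ ∀ x, ∑ y, P x y = 1

/-- An `η`-regular row-stochastic kernel: all entries positive, and
`P x y ≤ η * P x z`, `P y x ≤ η * P z x` for all `x, y, z`. -/
def IsRegularKernel {Z : Type*} [Fintype Z] (η : ℝ) (P : Z → Z → ℝ) : Prop :=
  IsRowStochastic P ∧ (∀ x y, 0 < P x y) ∧
    ∀ x y z, P x y ≤ η * P x z ∧ P y x ≤ η * P z x

/-- Variance of `φ` under the PMF `ν`. -/
def varPMF {Z : Type*} [Fintype Z] (ν φ : Z → ℝ) : ℝ :=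
  (∑ z, ν z * φ z ^ 2) - (∑ z, ν z * φ z) ^ 2

/-- Sup norm of a function on a finite nonempty type. -/
noncomputable def supNorm {Z : Type*} [Fintype Z] [Nonempty Z] (φ : Z → ℝ) : ℝ :=
  Finset.univ.sup' Finset.univ_nonempty fun z => |φ z|

/-- Weight of a single episode path of length `H = N + 1` under the initial law `μ` and
the transition kernels `P 0, …, P (N-1)` (so `P i` is the transition from step `i` to
step `i+1`). -/
def pathWeight {Z : Type*} [Fintype Z] (N : ℕ) (μ : Z → ℝ) (P : ℕ → Z → Z → ℝ)
    (x : Fin (N + 1) → Z) : ℝ :=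
  μ (x 0) * ∏ i : Fin N, P i (x i.castSucc) (x i.succ)

/-- Expectation of a path functional `g` under the single-episode path law. -/
noncomputable def pathExp {Z : Type*} [Fintype Z] (N : ℕ) (μ : Z → ℝ)
    (P : ℕ → Z → Z → ℝ) (g : (Fin (N + 1) → Z) → ℝ) : ℝ :=
  ∑ x : Fin (N + 1) → Z, pathWeight N μ P x * g x

lemma bern_scalar (t : ℝ) : (6 - 2 * t) * Real.exp t ≤ 6 + 4 * t + t ^ 2 := by
  have hG : Monotone (fun t : ℝ => 4 + 2 * t - (4 - 2 * t) * Real.exp t) := by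
    have hd : ∀ x : ℝ, HasDerivAt (fun t : ℝ => 4 + 2 * t - (4 - 2 * t) * Real.exp t)
        (2 - (2 - 2 * x) * Real.exp x) x := by
      intro x
      have h1 : HasDerivAt (fun t : ℝ => 4 + 2 * t) 2 x := by
        simpa using ((hasDerivAt_id x).const_mul 2).const_add 4
      have h2 : HasDerivAt (fun t : ℝ => 4 - 2 * t) (-2) x := by
        simpa using ((hasDerivAt_id x).const_mul 2).const_sub 4
      exact (h1.sub (h2.mul (Real.hasDerivAt_exp x))).congr_deriv (by ring)
    refine monotone_of_deriv_nonneg (fun x => (hd x).differentiableAt) (fun x => ?_)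
    rw [(hd x).deriv]
    have h := Real.add_one_le_exp (-x)
    have hp := Real.exp_pos x
    have : Real.exp (-x) * Real.exp x = 1 := by rw [← Real.exp_add]; simp
    nlinarith
  have hd : ∀ x : ℝ, HasDerivAt (fun t : ℝ => 6 + 4 * t + t ^ 2 - (6 - 2 * t) * Real.exp t)
      (4 + 2 * x - (4 - 2 * x) * Real.exp x) x := by
    intro x
    have h1 : HasDerivAt (fun t : ℝ => 6 + 4 * t + t ^ 2) (4 + 2 * x) x := by
      exact ((((hasDerivAt_id x).const_mul 4).const_add 6).add
        (hasDerivAt_pow 2 x)).congr_deriv (by simp)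
    have h2 : HasDerivAt (fun t : ℝ => 6 - 2 * t) (-2) x := by
      simpa using ((hasDerivAt_id x).const_mul 2).const_sub 6
    exact (h1.sub (h2.mul (Real.hasDerivAt_exp x))).congr_deriv (by ring)
  have hc : Continuous (fun t : ℝ => 6 + 4 * t + t ^ 2 - (6 - 2 * t) * Real.exp t) := by fun_prop
  rcases le_total 0 t with h | h
  · have hm : MonotoneOn (fun t : ℝ => 6 + 4 * t + t ^ 2 - (6 - 2 * t) * Real.exp t)
        (Set.Ici 0) := by
      refine monotoneOn_of_deriv_nonneg (convex_Ici 0) hc.continuousOn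
        (fun x _ => (hd x).differentiableAt.differentiableWithinAt) (fun x hx => ?_)
      rw [(hd x).deriv]
      have hx0 : x ∈ Set.Ici (0:ℝ) := interior_subset hx
      have := hG (show (0:ℝ) ≤ x from hx0)
      simpa using this
    have := hm (show (0:ℝ) ∈ Set.Ici 0 by simp) (show t ∈ Set.Ici (0:ℝ) from h) h
    simp at this; linarith
  · have hm : AntitoneOn (fun t : ℝ => 6 + 4 * t + t ^ 2 - (6 - 2 * t) * Real.exp t)
        (Set.Iic 0) := by
      refine antitoneOn_of_deriv_nonpos (convex_Iic 0) hc.continuousOn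
        (fun x _ => (hd x).differentiableAt.differentiableWithinAt) (fun x hx => ?_)
      rw [(hd x).deriv]
      have hx0 : x ∈ Set.Iic (0:ℝ) := interior_subset hx
      have := hG (show x ≤ (0:ℝ) from hx0)
      simpa using this
    have := hm (show t ∈ Set.Iic (0:ℝ) from h) (show (0:ℝ) ∈ Set.Iic 0 by simp) h
    simp at this; linarith

lemma bern_scalar2 (t s : ℝ) (hts : t ≤ s) (hs : s < 3) :
    Real.exp t ≤ 1 + t + t ^ 2 * (1 / (2 * (1 - s / 3))) := by
  have h := bern_scalar t
  have ht : 0 < 6 - 2 * t := by linarith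
  have h1 : Real.exp t ≤ (6 + 4 * t + t ^ 2) / (6 - 2 * t) := by
    rw [le_div_iff₀ ht]; linarith
  have h2 : (6 + 4 * t + t ^ 2) / (6 - 2 * t) = 1 + t + t ^ 2 * (1 / (2 * (1 - t / 3))) := by
    have e : 2 * (1 - t / 3) = (6 - 2 * t) / 3 := by ring
    have h6 := ht.ne'
    rw [e, one_div_div, div_eq_iff h6, add_mul, mul_assoc, div_mul_cancel₀ _ h6]
    ring
  have h3 : 1 / (2 * (1 - t / 3)) ≤ 1 / (2 * (1 - s / 3)) := by
    apply one_div_le_one_div_of_le <;> linarith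
  rw [h2] at h1
  nlinarith [sq_nonneg t, mul_le_mul_of_nonneg_left h3 (sq_nonneg t)]

section
variable {Z : Type*} [Fintype Z]

lemma varPMF_eq (ν f : Z → ℝ) (hν : IsPMF ν) :
    varPMF ν f = ∑ z, ν z * (f z - ∑ w, ν w * f w) ^ 2 := by
  set c := ∑ w, ν w * f w with hc
  have : ∀ z, ν z * (f z - c) ^ 2 = ν z * f z ^ 2 - 2 * c * (ν z * f z) + c ^ 2 * ν z := by
    intro z; ring
  simp only [this, sum_add_distrib, sum_sub_distrib, ← mul_sum, hν.2, ← hc]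
  unfold varPMF; rw [← hc]; ring

lemma mean_abs_le (ν p : Z → ℝ) (hν : IsPMF ν) (σ : ℝ) (hσ : 0 ≤ σ)
    (h : ∑ z, ν z * p z ^ 2 ≤ σ ^ 2) : ∑ z, ν z * |p z| ≤ σ := by
  have h0 : 0 ≤ ∑ z, ν z * (|p z| - ∑ w, ν w * |p w|) ^ 2 :=
    sum_nonneg fun z _ => mul_nonneg (hν.1 z) (sq_nonneg _)
  rw [← varPMF_eq ν (fun z => |p z|) hν] at h0
  unfold varPMF at h0
  simp only [sq_abs] at h0
  exact le_of_sq_le_sq (by linarith) hσ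

lemma one_step (μ f : Z → ℝ) (hμ : IsPMF μ) (b v l : ℝ) (hl : 0 ≤ l) (hlb : l * b < 3)
    (hosc : ∀ z z', f z - f z' ≤ b)
    (hvar : ∑ z, μ z * (f z - ∑ w, μ w * f w) ^ 2 ≤ v) :
    ∑ z, μ z * Real.exp (l * f z) ≤
      Real.exp (l * (∑ w, μ w * f w) + l ^ 2 * v / (2 * (1 - l * b / 3))) := by
  set c := ∑ w, μ w * f w with hc
  have hD : ∀ z, f z - c ≤ b := by
    intro z
    have : f z - c = ∑ w, μ w * (f z - f w) := by
      simp only [mul_sub, sum_sub_distrib, ← sum_mul, hμ.2, ← hc]; ring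
    rw [this]
    calc ∑ w, μ w * (f z - f w) ≤ ∑ w, μ w * b :=
          sum_le_sum fun w _ => mul_le_mul_of_nonneg_left (hosc z w) (hμ.1 w)
      _ = b := by rw [← sum_mul, hμ.2, one_mul]
  set k := 1 / (2 * (1 - l * b / 3)) with hk
  have hk0 : 0 ≤ k := by
    apply one_div_nonneg.2; linarith
  have h1 : ∑ z, μ z * Real.exp (l * (f z - c)) ≤ 1 + l ^ 2 * k * v := by
    calc ∑ z, μ z * Real.exp (l * (f z - c))
        ≤ ∑ z, μ z * (1 + l * (f z - c) + (l * (f z - c)) ^ 2 * k) :=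
          sum_le_sum fun z _ => mul_le_mul_of_nonneg_left
            (bern_scalar2 _ _ (mul_le_mul_of_nonneg_left (hD z) hl) hlb) (hμ.1 z)
      _ = ∑ z, ((1 - l * c) * μ z + l * (μ z * f z) + l ^ 2 * k * (μ z * (f z - c) ^ 2)) :=
          sum_congr rfl fun z _ => by ring
      _ = 1 + l ^ 2 * k * ∑ z, μ z * (f z - c) ^ 2 := by
          simp only [sum_add_distrib, ← mul_sum, hμ.2, ← hc]; ring
      _ ≤ _ := by gcongr
  have h2 : ∑ z, μ z * Real.exp (l * f z)
      = Real.exp (l * c) * ∑ z, μ z * Real.exp (l * (f z - c)) := by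
    rw [mul_sum]
    refine sum_congr rfl fun z _ => ?_
    rw [mul_left_comm, ← Real.exp_add]; ring_nf
  rw [h2, Real.exp_add]
  apply mul_le_mul_of_nonneg_left _ (Real.exp_pos _).le
  have h3 : l ^ 2 * v / (2 * (1 - l * b / 3)) = l ^ 2 * k * v := by rw [hk]; ring
  rw [h3]
  linarith [Real.add_one_le_exp (l ^ 2 * k * v)]

/-- Dobrushin contraction. -/
lemma dobrushin (η : ℝ) (hη : 1 ≤ η) (ν ν' f : Z → ℝ) (hν : IsPMF ν) (hν' : IsPMF ν')
    (h : ∀ z, ν' z ≤ η * ν z) (o : ℝ) (hf : ∀ z z', f z - f z' ≤ o) :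
    ∑ z, ν z * f z - ∑ z, ν' z * f z ≤ (1 - 1 / η) * o := by
  have hη0 : 0 < η := by linarith
  set c := ∑ z, ν' z * f z with hc
  have hD : ∀ z, f z - c ≤ o := by
    intro z
    have : f z - c = ∑ w, ν' w * (f z - f w) := by
      simp only [mul_sub, sum_sub_distrib, ← sum_mul, hν'.2, ← hc]; ring
    rw [this]
    calc ∑ w, ν' w * (f z - f w) ≤ ∑ w, ν' w * o :=
          sum_le_sum fun w _ => mul_le_mul_of_nonneg_left (hf z w) (hν'.1 w)
      _ = o := by rw [← sum_mul, hν'.2, one_mul]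
  have e1 : ∑ z, (ν z - 1 / η * ν' z) * (f z - c) = ∑ z, ν z * f z - c := by
    have : ∀ z, (ν z - 1 / η * ν' z) * (f z - c) =
        ν z * f z - 1 / η * (ν' z * f z) - c * ν z + c * (1 / η) * ν' z := by intro z; ring
    simp only [this, sum_add_distrib, sum_sub_distrib, ← mul_sum, hν.2, hν'.2, ← hc]; ring
  have e2 : ∑ z, (ν z - 1 / η * ν' z) * o = (1 - 1 / η) * o := by
    rw [← sum_mul, sum_sub_distrib, ← mul_sum, hν.2, hν'.2]; ring
  rw [← e1, ← e2]
  refine sum_le_sum fun z _ => mul_le_mul_of_nonneg_left (hD z) ?_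
  have : 1 / η * ν' z ≤ ν z := by
    rw [one_div, inv_mul_le_iff₀ hη0]; exact h z
  linarith

lemma std_diff (η : ℝ) (hη : 1 ≤ η) (ν ν' f : Z → ℝ) (hν : IsPMF ν) (hν' : IsPMF ν')
    (h : ∀ z, ν' z ≤ η * ν z) (h' : ∀ z, ν z ≤ η * ν' z) (σ : ℝ) (hσ : 0 ≤ σ)
    (hf : varPMF ν f ≤ σ ^ 2) :
    ∑ z, ν z * f z - ∑ z, ν' z * f z ≤ (η - 1) * σ := by
  rw [varPMF_eq ν f hν] at hf
  have h1 := mean_abs_le ν _ hν σ hσ hf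
  set c := ∑ z, ν z * f z with hc
  have e1 : c - ∑ z, ν' z * f z = ∑ z, (ν z - ν' z) * (f z - c) := by
    have : ∀ z, (ν z - ν' z) * (f z - c) =
        ν z * f z - (ν' z * f z) - c * ν z + c * ν' z := by intro z; ring
    simp only [this, sum_add_distrib, sum_sub_distrib, ← mul_sum, hν.2, hν'.2, ← hc]; ring
  rw [e1]
  calc ∑ z, (ν z - ν' z) * (f z - c) ≤ ∑ z, (η - 1) * (ν z * |f z - c|) := by
        refine sum_le_sum fun z _ => ?_
        have h2 : |ν z - ν' z| ≤ (η - 1) * ν z := by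
          have := h z
          have := h' z
          have := hν.1 z
          have := hν'.1 z
          rw [abs_le]; constructor
          · linarith
          · nlinarith
        calc (ν z - ν' z) * (f z - c) ≤ |ν z - ν' z| * |f z - c| := by
              rw [← abs_mul]; exact le_abs_self _
          _ ≤ (η - 1) * ν z * |f z - c| := by gcongr
          _ = _ := by ring
    _ = (η - 1) * ∑ z, ν z * |f z - c| := by rw [mul_sum]
    _ ≤ _ := by apply mul_le_mul_of_nonneg_left h1; linarith

lemma var_add (μ p q : Z → ℝ) (hμ : IsPMF μ) (σ a : ℝ) (hσ : 0 ≤ σ) (ha : 0 ≤ a)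
    (hp : varPMF μ p ≤ σ ^ 2) (hq : ∀ z z', q z - q z' ≤ a) :
    ∑ z, μ z * ((p z + q z) - ∑ w, μ w * (p w + q w)) ^ 2 ≤ (σ + a) ^ 2 := by
  rw [varPMF_eq μ p hμ] at hp
  have h1 := mean_abs_le μ _ hμ σ hσ hp
  simp only [mul_add, sum_add_distrib]
  set c := ∑ z, μ z * p z with hc
  set d := ∑ z, μ z * q z with hd
  have hD : ∀ z, |q z - d| ≤ a := by
    intro z
    have : q z - d = ∑ w, μ w * (q z - q w) := by
      simp only [mul_sub, sum_sub_distrib, ← sum_mul, hμ.2, ← hd]; ring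
    rw [this]
    calc |∑ w, μ w * (q z - q w)| ≤ ∑ w, |μ w * (q z - q w)| := abs_sum_le_sum_abs _ _
      _ ≤ ∑ w, μ w * a := by
          refine sum_le_sum fun w _ => ?_
          rw [abs_mul, abs_of_nonneg (hμ.1 w)]
          refine mul_le_mul_of_nonneg_left ?_ (hμ.1 w)
          rw [abs_le]; constructor
          · linarith [hq w z]
          · exact hq z w
      _ = a := by rw [← sum_mul, hμ.2, one_mul]
  calc ∑ z, μ z * (p z + q z - (c + d)) ^ 2
      ≤ ∑ z, (μ z * (p z - c) ^ 2 + 2 * a * (μ z * |p z - c|) + a ^ 2 * μ z) := by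
        refine sum_le_sum fun z _ => ?_
        have h2 : (p z + q z - (c + d)) ^ 2 ≤ (p z - c) ^ 2 + 2 * a * |p z - c| + a ^ 2 := by
          have h3 : |p z + q z - (c + d)| ≤ |p z - c| + a := by
            have : p z + q z - (c + d) = (p z - c) + (q z - d) := by ring
            rw [this]
            exact (abs_add_le _ _).trans (by linarith [hD z])
          have h4 := pow_le_pow_left₀ (abs_nonneg _) h3 2
          rw [sq_abs] at h4
          have := sq_abs (p z - c)
          nlinarith
        calc _ ≤ μ z * ((p z - c) ^ 2 + 2 * a * |p z - c| + a ^ 2) :=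
              mul_le_mul_of_nonneg_left h2 (hμ.1 z)
          _ = _ := by ring
    _ = ∑ z, μ z * (p z - c) ^ 2 + 2 * a * ∑ z, μ z * |p z - c| + a ^ 2 := by
        simp only [sum_add_distrib, ← mul_sum, hμ.2]; ring
    _ ≤ σ ^ 2 + 2 * a * σ + a ^ 2 := by gcongr
    _ = _ := by ring

/-! ### paths -/

lemma path_sum_split {N : ℕ} (F : (Fin (N + 1) → Z) → ℝ) :
    ∑ x, F x = ∑ z, ∑ x : Fin N → Z, F (Fin.cons z x) := by
  rw [← (Fin.consEquiv (fun _ : Fin (N + 1) => Z)).sum_comp, Fintype.sum_prod_type]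
  rfl

lemma pathWeight_cons (N : ℕ) (μ : Z → ℝ) (P : ℕ → Z → Z → ℝ) (z : Z) (x : Fin (N + 1) → Z) :
    pathWeight (N + 1) μ P (Fin.cons z x) =
      μ z * pathWeight N (P 0 z) (fun i => P (i + 1)) x := by
  unfold pathWeight
  rw [Fin.prod_univ_succ]
  simp [Fin.cons_succ]

lemma pathWeight_nonneg (N : ℕ) (μ : Z → ℝ) (P : ℕ → Z → Z → ℝ) (hμ : IsPMF μ)
    (hP : ∀ i < N, IsRowStochastic (P i)) (x : Fin (N + 1) → Z) : 0 ≤ pathWeight N μ P x :=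
  mul_nonneg (hμ.1 _) (prod_nonneg fun i _ => (hP i i.2).1 _ _)

lemma row_pmf {P : Z → Z → ℝ} (h : IsRowStochastic P) (z : Z) : IsPMF (P z) := ⟨h.1 z, h.2 z⟩

lemma pathWeight_zero (μ : Z → ℝ) (P : ℕ → Z → Z → ℝ) (x : Fin 1 → Z) :
    pathWeight 0 μ P x = μ (x 0) := by
  simp [pathWeight]

lemma pathWeight_sum (N : ℕ) (μ : Z → ℝ) (P : ℕ → Z → Z → ℝ) (hμ : IsPMF μ)
    (hP : ∀ i < N, IsRowStochastic (P i)) : ∑ x, pathWeight N μ P x = 1 := by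
  induction N generalizing μ P with
  | zero => rw [path_sum_split]; simpa [pathWeight_zero] using hμ.2
  | succ N ih =>
    rw [path_sum_split]
    simp only [pathWeight_cons, ← mul_sum]
    have : ∀ z, ∑ x, pathWeight N (P 0 z) (fun i => P (i + 1)) x = 1 := fun z =>
      ih _ _ (row_pmf (hP 0 (by omega)) z) (fun i hi => hP (i + 1) (by omega))
    simp [this, hμ.2]

/-- expected total reward -/
noncomputable def pmean (N : ℕ) (μ : Z → ℝ) (P : ℕ → Z → Z → ℝ) (φ : Fin (N + 1) → Z → ℝ) : ℝ :=
  ∑ x : Fin (N + 1) → Z, pathWeight N μ P x * ∑ h, φ h (x h)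

/-- continuation value -/
noncomputable def uval (N : ℕ) (P : ℕ → Z → Z → ℝ) (φ : Fin (N + 2) → Z → ℝ) (z : Z) : ℝ :=
  pmean N (P 0 z) (fun i => P (i + 1)) (fun h => φ h.succ)

lemma pmean_zero (μ : Z → ℝ) (P : ℕ → Z → Z → ℝ) (φ : Fin 1 → Z → ℝ) :
    pmean 0 μ P φ = ∑ z, μ z * φ 0 z := by
  unfold pmean; rw [path_sum_split]; simp [pathWeight_zero]

lemma pmean_succ (N : ℕ) (μ : Z → ℝ) (P : ℕ → Z → Z → ℝ) (φ : Fin (N + 2) → Z → ℝ)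
    (hP : ∀ i < N + 1, IsRowStochastic (P i)) :
    pmean (N + 1) μ P φ = ∑ z, μ z * (φ 0 z + uval N P φ z) := by
  unfold uval
  conv_lhs => unfold pmean
  rw [path_sum_split]
  refine sum_congr rfl fun z _ => ?_
  simp only [pathWeight_cons, mul_assoc, ← mul_sum]
  congr 1
  have hs := pathWeight_sum N (P 0 z) (fun i => P (i + 1)) (row_pmf (hP 0 (by omega)) z)
    (fun i hi => hP (i + 1) (by omega))
  unfold pmean
  simp only [Fin.sum_univ_succ (n := N + 1), Fin.cons_zero, Fin.cons_succ, mul_add,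
    sum_add_distrib, ← sum_mul, hs, one_mul]

lemma pmean_diff_std (η : ℝ) (hη : 1 ≤ η) (σ : ℝ) (hσ : 0 ≤ σ) (N : ℕ) (ν ν' : Z → ℝ)
    (P : ℕ → Z → Z → ℝ) (φ : Fin (N + 1) → Z → ℝ) (hν : IsPMF ν) (hν' : IsPMF ν')
    (h : ∀ z, ν' z ≤ η * ν z) (h' : ∀ z, ν z ≤ η * ν' z)
    (hP : ∀ i < N, IsRegularKernel η (P i))
    (h0 : varPMF ν (φ 0) ≤ σ ^ 2)
    (h1 : ∀ (i : Fin N) z, varPMF (P i z) (φ i.succ) ≤ σ ^ 2) :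
    pmean N ν P φ - pmean N ν' P φ ≤ η * (η - 1) * σ := by
  induction N generalizing ν ν' P with
  | zero =>
    rw [pmean_zero, pmean_zero]
    refine (std_diff η hη ν ν' _ hν hν' h h' σ hσ h0).trans ?_
    have : 0 ≤ (η - 1) * σ := mul_nonneg (by linarith) hσ
    nlinarith
  | succ N ih =>
    rw [pmean_succ _ _ _ _ fun i hi => (hP i hi).1, pmean_succ _ _ _ _ fun i hi => (hP i hi).1]
    simp only [mul_add, sum_add_distrib]
    have a1 := std_diff η hη ν ν' _ hν hν' h h' σ hσ h0
    have hr := hP 0 (by omega)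
    have a2 := dobrushin η hη ν ν' (uval N P φ) hν hν' h (η * (η - 1) * σ) (fun z z' =>
      ih (P 0 z) (P 0 z') (fun i => P (i + 1)) (fun h => φ h.succ) (row_pmf hr.1 z)
        (row_pmf hr.1 z') (fun w => (hr.2.2 w z' z).2) (fun w => (hr.2.2 w z z').2)
        (fun i hi => hP (i + 1) (by omega)) (h1 0 z) (fun i z => h1 i.succ z))
    have : (1 - 1 / η) * (η * (η - 1) * σ) = (η - 1) * (η - 1) * σ := by
      have : η ≠ 0 := by linarith
      field_simp
    rw [this] at a2
    linarith

lemma pmean_diff_osc (η : ℝ) (hη : 1 ≤ η) (B : ℝ) (N : ℕ) (ν ν' : Z → ℝ)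
    (P : ℕ → Z → Z → ℝ) (φ : Fin (N + 1) → Z → ℝ) (hν : IsPMF ν) (hν' : IsPMF ν')
    (h : ∀ z, ν' z ≤ η * ν z) (hB0 : 0 ≤ B)
    (hP : ∀ i < N, IsRegularKernel η (P i))
    (hB : ∀ h z z', φ h z - φ h z' ≤ B) :
    pmean N ν P φ - pmean N ν' P φ ≤ (η - 1) * B := by
  have hη0 : η ≠ 0 := by linarith
  have e : (1 - 1 / η) * (η * B) = (η - 1) * B := by field_simp
  rw [← e]
  induction N generalizing ν ν' P with
  | zero =>
    rw [pmean_zero, pmean_zero]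
    refine dobrushin η hη ν ν' _ hν hν' h _ (fun z z' => (hB 0 z z').trans ?_)
    nlinarith
  | succ N ih =>
    rw [pmean_succ _ _ _ _ fun i hi => (hP i hi).1, pmean_succ _ _ _ _ fun i hi => (hP i hi).1]
    have hr := hP 0 (by omega)
    refine dobrushin η hη ν ν' _ hν hν' h _ (fun z z' => ?_)
    have a2 := 
      ih (P 0 z) (P 0 z') (fun i => P (i + 1)) (fun h => φ h.succ) (row_pmf hr.1 z)
        (row_pmf hr.1 z') (fun w => (hr.2.2 w z' z).2) 
        (fun i hi => hP (i + 1) (by omega)) (fun h => hB h.succ)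
    rw [e] at a2
    have := hB 0 z z'
    change φ 0 z + pmean N (P 0 z) (fun i => P (i + 1)) (fun h => φ h.succ) -
      (φ 0 z' + pmean N (P 0 z') (fun i => P (i + 1)) (fun h => φ h.succ)) ≤ _
    linarith

lemma path_mgf (η : ℝ) (hη : 1 ≤ η) (σ : ℝ) (hσ : 0 ≤ σ) (B : ℝ) (hB0 : 0 ≤ B)
    (l : ℝ) (hl : 0 ≤ l) (hlb : l * (η * B) < 3) (N : ℕ) (μ : Z → ℝ)
    (P : ℕ → Z → Z → ℝ) (φ : Fin (N + 1) → Z → ℝ) (hμ : IsPMF μ)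
    (hP : ∀ i < N, IsRegularKernel η (P i))
    (h0 : varPMF μ (φ 0) ≤ σ ^ 2)
    (h1 : ∀ (i : Fin N) z, varPMF (P i z) (φ i.succ) ≤ σ ^ 2)
    (hB : ∀ h z z', φ h z - φ h z' ≤ B) :
    ∑ x, pathWeight N μ P x * Real.exp (l * ∑ h, φ h (x h)) ≤
      Real.exp (l * pmean N μ P φ + (N + 1) *
        (l ^ 2 * (σ + η * (η - 1) * σ) ^ 2 / (2 * (1 - l * (η * B) / 3)))) := by
  set K := l ^ 2 * (σ + η * (η - 1) * σ) ^ 2 / (2 * (1 - l * (η * B) / 3)) with hK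
  have ha : 0 ≤ η * (η - 1) * σ := mul_nonneg (mul_nonneg (by linarith) (by linarith)) hσ
  induction N generalizing μ P with
  | zero =>
    rw [pmean_zero, path_sum_split]
    simp only [pathWeight_zero, univ_unique, sum_singleton, Fin.default_eq_zero, Fin.cons_zero,
      Finset.sum_const, Finset.card_univ, Fintype.card_unique, one_smul]
    have hv := var_add μ (φ 0) (fun _ => 0) hμ σ _ hσ ha h0 (fun z z' => by simpa using ha)
    simp only [add_zero] at hv
    have := one_step μ (φ 0) hμ (η * B) _ l hl hlb
      (fun z z' => (hB 0 z z').trans (by nlinarith)) hv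
    simpa using this
  | succ N ih =>
    have hr := hP 0 (by omega)
    rw [pmean_succ _ _ _ _ fun i hi => (hP i hi).1, path_sum_split]
    have hosc : ∀ z z', (φ 0 z + uval N P φ z) - (φ 0 z' + uval N P φ z') ≤ η * B := by
      intro z z'
      have a2 : uval N P φ z - uval N P φ z' ≤ (η - 1) * B := 
        pmean_diff_osc η hη B N (P 0 z) (P 0 z') (fun i => P (i + 1)) (fun h => φ h.succ)
          (row_pmf hr.1 z) (row_pmf hr.1 z') (fun w => (hr.2.2 w z' z).2) hB0
          (fun i hi => hP (i + 1) (by omega)) (fun h => hB h.succ)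
      have := hB 0 z z'
      linarith
    have hu : ∀ z z', uval N P φ z - uval N P φ z' ≤ η * (η - 1) * σ := fun z z' =>
      pmean_diff_std η hη σ hσ N (P 0 z) (P 0 z') (fun i => P (i + 1)) (fun h => φ h.succ)
        (row_pmf hr.1 z)
        (row_pmf hr.1 z') (fun w => (hr.2.2 w z' z).2) (fun w => (hr.2.2 w z z').2)
        (fun i hi => hP (i + 1) (by omega)) (h1 0 z) (fun i z => h1 i.succ z)
    have hv := var_add μ (φ 0) (uval N P φ) hμ σ _ hσ ha h0 hu
    have hs := one_step μ (fun z => φ 0 z + uval N P φ z) hμ (η * B) _ l hl hlb hosc hv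
    rw [← hK] at hs
    have hin : ∀ z, ∑ x, pathWeight (N + 1) μ P (Fin.cons z x) *
        Real.exp (l * ∑ h, φ h ((Fin.cons z x : Fin (N + 2) → Z) h)) ≤
        μ z * Real.exp (l * (φ 0 z + uval N P φ z)) * Real.exp ((N + 1) * K) := by
      intro z
      have := ih (P 0 z) (fun i => P (i + 1)) (fun h => φ h.succ)
        (row_pmf hr.1 z) (fun i hi => hP (i + 1) (by omega)) (h1 0 z) (fun i z => h1 i.succ z)
        (fun h => hB h.succ)
      have e : ∑ x, pathWeight (N + 1) μ P (Fin.cons z x) *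
        Real.exp (l * ∑ h, φ h ((Fin.cons z x : Fin (N + 2) → Z) h)) =
        μ z * (Real.exp (l * φ 0 z) * ∑ x, pathWeight N (P 0 z) (fun i => P (i + 1)) x *
          Real.exp (l * ∑ h, φ (Fin.succ h) (x h))) := by
        rw [mul_sum, mul_sum]
        refine sum_congr rfl fun x _ => ?_
        rw [pathWeight_cons, Fin.sum_univ_succ (n := N + 1), mul_add, Real.exp_add]
        simp only [Fin.cons_zero, Fin.cons_succ]
        ring
      rw [e, mul_assoc]
      refine mul_le_mul_of_nonneg_left ?_ (hμ.1 z)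
      refine (mul_le_mul_of_nonneg_left this (Real.exp_pos _).le).trans (le_of_eq ?_)
      rw [← Real.exp_add, ← Real.exp_add]
      congr 1
      unfold uval
      ring
    refine (sum_le_sum fun z _ => hin z).trans ?_
    rw [← sum_mul]
    refine (mul_le_mul_of_nonneg_right hs (Real.exp_pos _).le).trans (le_of_eq ?_)
    rw [← Real.exp_add]
    congr 1
    push_cast
    ring

lemma prod_law (T : ℕ) {X : Type*} [Fintype X] (w s : X → ℝ) (hw : ∀ x, 0 ≤ w x)
    (l : ℝ) (hl : 0 ≤ l) (ρ : ℝ) :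
    (∑ ω : Fin T → X, if ρ < ∑ t, s (ω t) then ∏ t, w (ω t) else 0) ≤
      Real.exp (-(l * ρ)) * (∑ x, w x * Real.exp (l * s x)) ^ T := by
  classical
  have e : (∑ x, w x * Real.exp (l * s x)) ^ T =
      ∑ ω : Fin T → X, ∏ t, (w (ω t) * Real.exp (l * s (ω t))) := by
    have := Finset.prod_univ_sum (fun _ : Fin T => (univ : Finset X))
      (fun _ x => w x * Real.exp (l * s x))
    simpa using this
  rw [e, mul_sum]
  refine sum_le_sum fun ω _ => ?_
  have hp : 0 ≤ ∏ t, w (ω t) := prod_nonneg fun t _ => hw _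
  rw [prod_mul_distrib, ← Real.exp_sum, ← mul_sum, mul_left_comm, ← Real.exp_add]
  split_ifs with h
  · have : 1 ≤ Real.exp (-(l * ρ) + l * ∑ t, s (ω t)) := by
      apply Real.one_le_exp
      nlinarith
    nlinarith
  · positivity

end

/-- **Bernstein-type concentration for Markov chains with restarts.**
Episodes have horizon `H = N + 1`; steps are indexed by `Fin (N+1)` and the transition
from step `h` to step `h+1` is `P h` (so `P 0, …, P (N-1)` play the role of the paper's
`P₁, …, P_{H−1}`).  The measure `P_{ℓ−1}(z,·)` (with the convention `P₀(z,·) = μ`)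
corresponds, in 0-based indexing `ℓ₀ = ℓ − 1 ∈ {0,…,N}`, to `μ` if `ℓ₀ = 0` and to the
row `P (ℓ₀ − 1) z` otherwise. -/
theorem bernstein_markov_with_restarts
    {Z : Type*} [Fintype Z] [Nonempty Z]
    (N T : ℕ) (η : ℝ) (hη : 1 ≤ η)
    (μ : Z → ℝ) (hμ : IsRegularPMF η μ)
    (P : ℕ → Z → Z → ℝ) (hP : ∀ i < N, IsRegularKernel η (P i))
    (φ : Fin (N + 1) → Z → ℝ)
    (hφ : ¬ ∀ (h : Fin (N + 1)) (z z' : Z), φ h z = φ h z')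
    (V M : ℝ)
    (hV : V = (1 + Real.sqrt 2 * η * (2 * η - 1)) ^ 2 *
      Finset.univ.sup' Finset.univ_nonempty
        (fun p : Z × Fin (N + 1) × Fin (N + 1) =>
          if p.2.1 ≤ p.2.2 then
            varPMF (if p.2.1.val = 0 then μ else P (p.2.1.val - 1) p.1) (φ p.2.2)
          else 0))
    (hM : M = 2 * (2 * η - 1) *
      Finset.univ.sup' Finset.univ_nonempty (fun h : Fin (N + 1) => supNorm (φ h)))
    (ρ : ℝ) (hρ : 0 ≤ ρ) :
    (∑ ω : Fin T → Fin (N + 1) → Z,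
        if ρ < ∑ t, ∑ h, (φ h (ω t h) - pathExp N μ P (fun x => φ h (x h))) then
          ∏ t, pathWeight N μ P (ω t)
        else 0)
      ≤ Real.exp (-ρ ^ 2 / (2 * T * (N + 1) * V + 2 / 3 * M * ρ)) := by
  classical
  have hμ' := hμ.1
  have hPs : ∀ i < N, IsRowStochastic (P i) := fun i hi => (hP i hi).1
  -- the two maxima
  set S := Finset.univ.sup' Finset.univ_nonempty
        (fun p : Z × Fin (N + 1) × Fin (N + 1) =>
          if p.2.1 ≤ p.2.2 then
            varPMF (if p.2.1.val = 0 then μ else P (p.2.1.val - 1) p.1) (φ p.2.2)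
          else 0) with hS
  set Φ := Finset.univ.sup' Finset.univ_nonempty (fun h : Fin (N + 1) => supNorm (φ h)) with hΦ
  have hle : ∀ p : Z × Fin (N + 1) × Fin (N + 1), (if p.2.1 ≤ p.2.2 then
            varPMF (if p.2.1.val = 0 then μ else P (p.2.1.val - 1) p.1) (φ p.2.2)
          else 0) ≤ S := fun p => Finset.le_sup' (fun p : Z × Fin (N + 1) × Fin (N + 1) =>
          if p.2.1 ≤ p.2.2 then
            varPMF (if p.2.1.val = 0 then μ else P (p.2.1.val - 1) p.1) (φ p.2.2)
          else 0) (Finset.mem_univ p)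
  have habs : ∀ h z, |φ h z| ≤ Φ := by
    intro h z
    have a1 : |φ h z| ≤ supNorm (φ h) := Finset.le_sup' (fun z => |φ h z|) (Finset.mem_univ z)
    have a2 : supNorm (φ h) ≤ Φ :=
      Finset.le_sup' (fun h : Fin (N + 1) => supNorm (φ h)) (Finset.mem_univ h)
    exact a1.trans a2
  have hvar0 : ∀ h, varPMF μ (φ h) ≤ S := by
    intro h
    have := hle (Classical.arbitrary Z, 0, h)
    simpa using this
  have hvar1 : ∀ (i : Fin N) z, varPMF (P i z) (φ i.succ) ≤ S := by
    intro i z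
    have := hle (z, i.succ, i.succ)
    simpa using this
  have hμpos : ∀ z, 0 < μ z := by
    intro z
    by_contra hz
    have h0 : ∀ x, μ x ≤ 0 := fun x => (hμ.2 x z).trans (by nlinarith)
    have : ∑ x, μ x ≤ 0 := Finset.sum_nonpos fun x _ => h0 x
    linarith [hμ'.2]
  push Not at hφ
  obtain ⟨h₀, z₀, z₁, hne⟩ := hφ
  have hSpos : 0 < S := by
    refine lt_of_lt_of_le ?_ (hvar0 h₀)
    rw [varPMF_eq _ _ hμ']
    set c := ∑ w, μ w * φ h₀ w
    have : ∃ z, φ h₀ z ≠ c := by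
      by_contra hcon
      push Not at hcon
      exact hne ((hcon z₀).trans (hcon z₁).symm)
    obtain ⟨z, hz⟩ := this
    refine Finset.sum_pos' (fun w _ => mul_nonneg (hμ'.1 w) (sq_nonneg _)) ⟨z, Finset.mem_univ z, ?_⟩
    have : φ h₀ z - c ≠ 0 := sub_ne_zero.2 hz
    have := hμpos z
    positivity
  have hΦ0 : 0 ≤ Φ := (abs_nonneg _).trans (habs h₀ z₀)
  set m := ∑ h, pathExp N μ P (fun x => φ h (x h)) with hm
  have hmm : pmean N μ P φ = m := by
    rw [hm]; unfold pmean pathExp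
    simp only [Finset.mul_sum]
    rw [Finset.sum_comm]
  have hVpos : 0 < V := by
    rw [hV]
    have : 0 ≤ Real.sqrt 2 * η * (2 * η - 1) := by
      have : 0 ≤ 2 * η - 1 := by linarith
      positivity
    positivity
  have hM0 : 0 ≤ M := by
    rw [hM]
    have : 0 ≤ 2 * η - 1 := by linarith
    positivity
  -- trivial case
  rcases Nat.eq_zero_or_pos T with hT | hT
  · subst hT
    simp only [Finset.univ_eq_empty, Finset.sum_empty, Finset.prod_empty, not_lt.2 hρ, if_false,
      Finset.sum_const_zero]
    exact (Real.exp_pos _).le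
  have hTpos : (0:ℝ) < T := by exact_mod_cast hT
  set A : ℝ := T * (N + 1) * V with hA
  have hApos : 0 < A := by positivity
  set l : ℝ := ρ / (A + M * ρ / 3) with hl
  have hden : 0 < A + M * ρ / 3 := by positivity
  have hl0 : 0 ≤ l := by positivity
  have hlM : 1 - l * M / 3 = A / (A + M * ρ / 3) := by
    rw [hl]; field_simp; ring
  have hlM3 : l * M < 3 := by
    have : 0 < A / (A + M * ρ / 3) := by positivity
    linarith
  have hηB : η * (2 * Φ) ≤ M := by
    rw [hM]; nlinarith
  have hlB : l * (η * (2 * Φ)) ≤ l * M := mul_le_mul_of_nonneg_left hηB hl0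
  have hsq : Real.sqrt S ^ 2 = S := Real.sq_sqrt hSpos.le
  have hmgf := path_mgf η hη (Real.sqrt S) (Real.sqrt_nonneg _) (2 * Φ) (by linarith) l hl0
    (by linarith) N μ P φ hμ' hP (by rw [hsq]; exact hvar0 0)
    (fun i z => by rw [hsq]; exact hvar1 i z)
    (fun h z z' => by
      have := abs_le.1 (habs h z)
      have := abs_le.1 (habs h z')
      linarith)
  have hvV : (Real.sqrt S + η * (η - 1) * Real.sqrt S) ^ 2 ≤ V := by
    have : (Real.sqrt S + η * (η - 1) * Real.sqrt S) ^ 2 = (1 + η * (η - 1)) ^ 2 * S := by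
      rw [← hsq]; ring_nf; simp [hsq]
    rw [this, hV]
    have h2 : 1 ≤ Real.sqrt 2 := by
      rw [Real.one_le_sqrt]; norm_num
    have h3 : η * (η - 1) ≤ Real.sqrt 2 * η * (2 * η - 1) := by
      have : 0 ≤ η * (2 * η - 1) := mul_nonneg (by linarith) (by linarith)
      nlinarith
    have h4 : 0 ≤ η * (η - 1) := mul_nonneg (by linarith) (by linarith)
    gcongr
  set w := pathWeight N μ P with hw
  have hlaw := prod_law T w (fun x => ∑ h, (φ h (x h) - pathExp N μ P (fun x => φ h (x h))))
    (pathWeight_nonneg N μ P hμ' hPs) l hl0 ρ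
  refine hlaw.trans ?_
  set K := l ^ 2 * V / (2 * (1 - l * M / 3)) with hK
  have hKle : l ^ 2 * (Real.sqrt S + η * (η - 1) * Real.sqrt S) ^ 2 /
      (2 * (1 - l * (η * (2 * Φ)) / 3)) ≤ K := by
    rw [hK]
    apply div_le_div₀
    · positivity
    · exact mul_le_mul_of_nonneg_left hvV (sq_nonneg _)
    · linarith
    · linarith
  have hone : ∑ x, w x * Real.exp (l * ∑ h, (φ h (x h) - pathExp N μ P (fun x => φ h (x h)))) ≤
      Real.exp ((N + 1) * K) := by
    have e : ∑ x, w x * Real.exp (l * ∑ h, (φ h (x h) - pathExp N μ P (fun x => φ h (x h)))) =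
        Real.exp (-(l * m)) * ∑ x, w x * Real.exp (l * ∑ h, φ h (x h)) := by
      rw [Finset.mul_sum]
      refine Finset.sum_congr rfl fun x _ => ?_
      rw [mul_left_comm, ← Real.exp_add, Finset.sum_sub_distrib, ← hm]
      ring_nf
    rw [e]
    refine (mul_le_mul_of_nonneg_left hmgf (Real.exp_pos _).le).trans ?_
    rw [← Real.exp_add, hmm]
    apply Real.exp_le_exp.2
    have := mul_le_mul_of_nonneg_left hKle (show (0:ℝ) ≤ N + 1 by positivity)
    linarith
  have hpow : (∑ x, w x * Real.exp (l * ∑ h, (φ h (x h) - pathExp N μ P (fun x => φ h (x h))))) ^ T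
      ≤ Real.exp (T * ((N + 1) * K)) := by
    rw [Real.exp_nat_mul]
    refine pow_le_pow_left₀ ?_ hone T
    exact Finset.sum_nonneg fun x _ => mul_nonneg (pathWeight_nonneg N μ P hμ' hPs x)
      (Real.exp_pos _).le
  refine (mul_le_mul_of_nonneg_left hpow (Real.exp_pos _).le).trans (le_of_eq ?_)
  rw [← Real.exp_add]
  congr 1
  have e1 : (T:ℝ) * ((N + 1) * K) = l ^ 2 * A / (2 * (1 - l * M / 3)) := by
    rw [hK, hA]; ring
  have e2 : 2 * (T:ℝ) * (N + 1) * V + 2 / 3 * M * ρ = 2 * (A + M * ρ / 3) := by rw [hA]; ring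
  rw [e1, e2, hlM, hl]
  have hA0 := hApos.ne'
  have hd0 := hden.ne'
  generalize A + M * ρ / 3 = D at hd0 ⊢
  field_simp
  ring
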